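/- arXiv:1809.02334 — 4 statements merged into one kernel-verified Lean document; each statement's English description precedes it below -/
import Mathlib

section
/- Let r, n, N be natural numbers with 1 ≤ r ≤ n < N, and let A be an N × r complex matrix. Suppose I is a set of n row indices such that the submatrix A_I has nonzero volume and has locally maximal volume with respect to single-row exchanges, i.e. for every j ∈ I and every i ∉ I one has V(A_{(I\{j})∪{i}}) ≤ V(A_I). Then for every set T of n row indices, V(A_T) ≤ V(A_I) · ((n+1)/(n−r+1))^{r/2}; equivalently, det((A_T)ᴴ A_T) ≤ ((n+1)/(n−r+1))^r · det((A_I)ᴴ A_I). -/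
open Matrix BigOperators

/-- The submatrix of `A` consisting of the rows indexed by the finite set `S`. -/
def rowsSub {N r : ℕ} (A : Matrix (Fin N) (Fin r) ℂ) (S : Finset (Fin N)) :
    Matrix {x // x ∈ S} (Fin r) ℂ :=
  A.submatrix (fun x : {x // x ∈ S} => (x : Fin N)) id

/-- The squared volume `det(BᴴB)` (a nonnegative real) of the row submatrix `A_S`. -/
noncomputable def sqVol {N r : ℕ} (A : Matrix (Fin N) (Fin r) ℂ) (S : Finset (Fin N)) : ℝ :=
  (((rowsSub A S)ᴴ * rowsSub A S).det).re

open scoped ComplexOrder MatrixOrder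

section RowGram

variable {N r : ℕ}

/-- The squared Euclidean norm of the `k`-th row. -/
noncomputable def sqRowNorm (A : Matrix (Fin N) (Fin r) ℂ) (k : Fin N) : ℝ :=
  (A k ⬝ᵥ star (A k)).re

lemma coe_sqRowNorm (A : Matrix (Fin N) (Fin r) ℂ) (k : Fin N) :
    (sqRowNorm A k : ℂ) = A k ⬝ᵥ star (A k) :=
  Complex.conj_eq_iff_re.mp (by simp [dotProduct, mul_comm])

lemma sqRowNorm_nonneg (A : Matrix (Fin N) (Fin r) ℂ) (k : Fin N) : 0 ≤ sqRowNorm A k := by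
  have h := dotProduct_star_self_nonneg (A k)
  rw [dotProduct_comm, ← coe_sqRowNorm] at h
  exact_mod_cast h

lemma conjTranspose_mul_rowsSub (A : Matrix (Fin N) (Fin r) ℂ) (S : Finset (Fin N)) :
    (rowsSub A S)ᴴ * rowsSub A S = ∑ k ∈ S, vecMulVec (star (A k)) (A k) := by
  ext a b
  simp only [mul_apply, conjTranspose_apply, rowsSub, submatrix_apply, id, Matrix.sum_apply,
    vecMulVec_apply, Pi.star_apply]
  exact Finset.sum_coe_sort S fun k => star (A k a) * A k b

lemma re_trace_conjTranspose_mul_rowsSub (A : Matrix (Fin N) (Fin r) ℂ) (S : Finset (Fin N)) :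
    ((rowsSub A S)ᴴ * rowsSub A S).trace.re = ∑ k ∈ S, sqRowNorm A k := by
  rw [conjTranspose_mul_rowsSub, trace_sum, Complex.re_sum]
  simp only [trace_vecMulVec, sqRowNorm, dotProduct_comm]

lemma rowsSub_mul (A : Matrix (Fin N) (Fin r) ℂ) (B : Matrix (Fin r) (Fin r) ℂ)
    (S : Finset (Fin N)) : rowsSub (A * B) S = rowsSub A S * B := by
  ext a b
  simp [rowsSub, mul_apply]

lemma sqVol_mul (A : Matrix (Fin N) (Fin r) ℂ) (B : Matrix (Fin r) (Fin r) ℂ)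
    (S : Finset (Fin N)) : sqVol (A * B) S = Complex.normSq B.det * sqVol A S := by
  rw [sqVol, rowsSub_mul, conjTranspose_mul, Matrix.mul_assoc, ← Matrix.mul_assoc _ _ B, det_mul,
    det_mul, det_conjTranspose, mul_comm, mul_assoc, Complex.star_def, Complex.mul_conj, mul_comm,
    Complex.re_ofReal_mul, sqVol]

end RowGram

lemma det_one_sub_vecMulVec_add_vecMulVec {m : Type*} [Fintype m] [DecidableEq m]
    (u v : m → ℂ) :
    (1 - vecMulVec (star v) v + vecMulVec (star u) u).det =
      (1 - v ⬝ᵥ star v) * (1 + u ⬝ᵥ star u) + (u ⬝ᵥ star v) * (v ⬝ᵥ star u) := by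
  have h : 1 - vecMulVec (star v) v + vecMulVec (star u) u =
      1 + (of ![-star v, star u])ᵀ * of ![v, u] := by
    ext a b
    simp [mul_apply, vecMulVec_apply, Fin.sum_univ_two]
    ring
  have h' : 1 + of ![v, u] * (of ![-star v, star u])ᵀ =
      !![1 - v ⬝ᵥ star v, v ⬝ᵥ star u; -(u ⬝ᵥ star v), 1 + u ⬝ᵥ star u] := by
    ext a b
    fin_cases a <;> fin_cases b <;>
      simp [vecMul, dotProduct, sub_eq_add_neg]
  rw [h, det_one_add_mul_comm, h', det_fin_two_of]
  ring

/-- The determinant-trace inequality for positive semidefinite matrices. -/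
lemma Matrix.PosSemidef.re_det_le {r : ℕ} (hr : r ≠ 0) {M : Matrix (Fin r) (Fin r) ℂ}
    (hM : M.PosSemidef) : M.det.re ≤ (M.trace.re / r) ^ r := by
  rw [hM.1.det_eq_prod_eigenvalues, hM.1.trace_eq_sum_eigenvalues]
  have hnn := hM.eigenvalues_nonneg
  generalize hM.1.eigenvalues = e at hnn ⊢
  have h := Real.geom_mean_le_arith_mean Finset.univ (fun _ => (1 : ℝ)) e (by simp)
    (by simpa using Nat.pos_of_ne_zero hr) (fun i _ => hnn i)
  simp only [Real.rpow_one, one_mul, Finset.sum_const, Finset.card_univ, Fintype.card_fin,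
    nsmul_eq_mul, mul_one] at h
  have h2 := pow_le_pow_left₀
    (Real.rpow_nonneg (Finset.prod_nonneg fun i _ => hnn i) _) h r
  rw [Real.rpow_inv_natCast_pow (Finset.prod_nonneg fun i _ => hnn i) hr] at h2
  have e1 : (∏ i, ((e i : ℝ) : ℂ)).re = ∏ i, e i := by
    rw [← Complex.ofReal_prod, Complex.ofReal_re]
  have e2 : (∑ i, ((e i : ℝ) : ℂ)).re = ∑ i, e i := by
    rw [← Complex.ofReal_sum, Complex.ofReal_re]
  exact e1.trans_le (h2.trans_eq (by rw [← e2]; rfl))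

section Normalized

variable {N r : ℕ} {A : Matrix (Fin N) (Fin r) ℂ} {I : Finset (Fin N)}

lemma sqVol_insert_erase (hG : (rowsSub A I)ᴴ * rowsSub A I = 1) {i j : Fin N} (hj : j ∈ I)
    (hi : i ∉ I) :
    sqVol A (insert i (I.erase j)) = (1 - sqRowNorm A j) * (1 + sqRowNorm A i) +
      Complex.normSq (A i ⬝ᵥ star (A j)) := by
  have hG' := hG
  rw [conjTranspose_mul_rowsSub, ← Finset.add_sum_erase _ _ hj] at hG'
  rw [sqVol, conjTranspose_mul_rowsSub,
    Finset.sum_insert (fun h => hi (Finset.mem_of_mem_erase h)), add_comm,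
    eq_sub_of_add_eq' hG', det_one_sub_vecMulVec_add_vecMulVec]
  have hc : A j ⬝ᵥ star (A i) = star (A i ⬝ᵥ star (A j)) := dotProduct_star _ _
  rw [hc, Complex.star_def, Complex.mul_conj, ← coe_sqRowNorm, ← coe_sqRowNorm]
  norm_cast

lemma sum_normSq_dotProduct_star (hG : (rowsSub A I)ᴴ * rowsSub A I = 1) (i : Fin N) :
    ∑ j ∈ I, Complex.normSq (A i ⬝ᵥ star (A j)) = sqRowNorm A i := by
  have h : A i ⬝ᵥ ((∑ k ∈ I, vecMulVec (star (A k)) (A k)) *ᵥ star (A i)) =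
      A i ⬝ᵥ star (A i) := by
    rw [← conjTranspose_mul_rowsSub, hG, one_mulVec]
  rw [← Complex.ofReal_inj, coe_sqRowNorm, ← h, Complex.ofReal_sum, sum_mulVec, dotProduct_sum]
  refine Finset.sum_congr rfl fun j _ => ?_
  have hc : A j ⬝ᵥ star (A i) = star (A i ⬝ᵥ star (A j)) := dotProduct_star _ _
  rw [vecMulVec_mulVec, hc, ← Complex.mul_conj, Complex.star_def]
  simp [dotProduct_smul, mul_comm]

lemma sum_sqRowNorm_eq (hG : (rowsSub A I)ᴴ * rowsSub A I = 1) :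
    ∑ j ∈ I, sqRowNorm A j = r := by
  rw [← re_trace_conjTranspose_mul_rowsSub, hG]
  simp

lemma sqVol_eq_one (hG : (rowsSub A I)ᴴ * rowsSub A I = 1) : sqVol A I = 1 := by
  rw [sqVol, hG]
  simp

/-- Summing the exchange inequalities over a set of removed rows bounds the norm of an
outside row. -/
lemma sqRowNorm_mul_le (hG : (rowsSub A I)ᴴ * rowsSub A I = 1)
    (hloc : ∀ j ∈ I, ∀ i ∉ I, sqVol A (insert i (I.erase j)) ≤ sqVol A I)
    {J : Finset (Fin N)} (hJ : J ⊆ I) {i : Fin N} (hi : i ∉ I) :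
    sqRowNorm A i * (J.card - ∑ j ∈ J, sqRowNorm A j) +
      ∑ j ∈ J, Complex.normSq (A i ⬝ᵥ star (A j)) ≤ ∑ j ∈ J, sqRowNorm A j := by
  have h : ∀ j ∈ J, sqRowNorm A i * (1 - sqRowNorm A j) +
      Complex.normSq (A i ⬝ᵥ star (A j)) ≤ sqRowNorm A j := fun j hj => by
    have := hloc j (hJ hj) i hi
    rw [sqVol_insert_erase hG (hJ hj) hi, sqVol_eq_one hG] at this
    linarith
  simpa [Finset.sum_add_distrib, ← Finset.mul_sum] using Finset.sum_le_sum h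

lemma sum_sqRowNorm_le {n : ℕ} (hrn : r ≤ n) (hI : I.card = n)
    (hG : (rowsSub A I)ᴴ * rowsSub A I = 1)
    (hloc : ∀ j ∈ I, ∀ i ∉ I, sqVol A (insert i (I.erase j)) ≤ sqVol A I)
    {T : Finset (Fin N)} (hT : T.card = n) :
    ∑ k ∈ T, sqRowNorm A k ≤ r * ((n + 1) / (n - r + 1)) := by
  set L := ∑ j ∈ I \ T, sqRowNorm A j
  set X := ∑ i ∈ T \ I, sqRowNorm A i with hX
  set m := (I \ T).card
  have hm' : (T \ I).card = m := Finset.card_sdiff_comm (hT.trans hI.symm)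
  have hmn : (m : ℝ) ≤ n := by
    rw [← hI]
    exact_mod_cast Finset.card_le_card Finset.sdiff_subset
  have hrn' : (r : ℝ) ≤ n := by exact_mod_cast hrn
  have hr0 : (0 : ℝ) ≤ r := r.cast_nonneg
  have hX0 : 0 ≤ X := Finset.sum_nonneg fun i _ => sqRowNorm_nonneg A i
  have hL0 : 0 ≤ L := Finset.sum_nonneg fun i _ => sqRowNorm_nonneg A i
  have hsum : ∑ k ∈ T, sqRowNorm A k = r - L + X := by
    have h1 := Finset.sum_inter_add_sum_sdiff I T (sqRowNorm A)
    have h2 := Finset.sum_inter_add_sum_sdiff T I (sqRowNorm A)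
    rw [sum_sqRowNorm_eq hG] at h1
    rw [Finset.inter_comm] at h2
    linarith
  have hglobal : X * (n - r + 1) ≤ m * r := by
    have h := Finset.sum_le_card_nsmul (T \ I) (fun i => sqRowNorm A i * (n - r + 1)) r
      fun i hi => by
        have := sqRowNorm_mul_le hG hloc subset_rfl (Finset.mem_sdiff.mp hi).2
        rw [sum_normSq_dotProduct_star hG, sum_sqRowNorm_eq hG, hI] at this
        linarith
    rwa [← Finset.sum_mul, nsmul_eq_mul, hm'] at h
  have hlocal : X * (m - L) ≤ m * L := by
    have h := Finset.sum_le_card_nsmul (T \ I) (fun i => sqRowNorm A i * (m - L)) L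
      fun i hi => by
        have := sqRowNorm_mul_le hG hloc (Finset.sdiff_subset (t := T))
          (Finset.mem_sdiff.mp hi).2
        have h0 : 0 ≤ ∑ j ∈ I \ T, Complex.normSq (A i ⬝ᵥ star (A j)) :=
          Finset.sum_nonneg fun j _ => Complex.normSq_nonneg _
        linarith
    rwa [← Finset.sum_mul, nsmul_eq_mul, hm'] at h
  have hD : (0 : ℝ) < n - r + 1 := by linarith
  have hn1 : (0 : ℝ) < n + 1 := by linarith
  rw [hsum, ← mul_div_assoc, le_div_iff₀ hD]
  suffices (X - L) * (n - r + 1) ≤ r * r by linarith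
  have hmr : (m : ℝ) * (r * r) ≤ r * r * (n + 1) := by nlinarith [mul_nonneg hr0 hr0]
  refine le_of_mul_le_mul_right ?_ hn1
  refine le_trans ?_ hmr
  rcases le_total (m * r : ℝ) (L * (n + 1)) with h | h
  · nlinarith [mul_le_mul_of_nonneg_right hglobal hn1.le, mul_le_mul_of_nonneg_right h hD.le]
  · rcases (Nat.cast_nonneg (α := ℝ) m).eq_or_lt with h0 | h0
    · have : X = 0 := by
        have hc : T \ I = ∅ := Finset.card_eq_zero.mp (by rw [hm']; exact_mod_cast h0.symm)
        rw [hX, hc, Finset.sum_empty]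
      rw [this, ← h0]
      nlinarith [mul_nonneg (mul_nonneg hL0 hD.le) hn1.le]
    · have h1 : X * (m * (n - r + 1)) ≤ m * L * (n + 1) := by
        nlinarith [mul_le_mul_of_nonneg_right hlocal hn1.le, mul_le_mul_of_nonneg_left h hX0]
      have h2 : X * (n - r + 1) ≤ L * (n + 1) := by
        refine le_of_mul_le_mul_left ?_ h0
        linarith
      nlinarith [mul_le_mul_of_nonneg_right h2 hn1.le, mul_le_mul_of_nonneg_left h hr0]

end Normalized

/-- If `A_I` (an `n × r` row submatrix of an `N × r` matrix, `1 ≤ r ≤ n < N`) has nonzero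
volume and locally maximal volume with respect to single-row exchanges, then the squared
volume of any `n × r` row submatrix is at most `((n+1)/(n-r+1))^r` times that of `A_I`. -/
theorem statement0 (r n N : ℕ) (hr : 1 ≤ r) (hrn : r ≤ n) (hnN : n < N)
    (A : Matrix (Fin N) (Fin r) ℂ) (I : Finset (Fin N)) (hI : I.card = n)
    (hvol : sqVol A I ≠ 0)
    (hloc : ∀ j ∈ I, ∀ i ∉ I, sqVol A (insert i (I.erase j)) ≤ sqVol A I) :
    ∀ T : Finset (Fin N), T.card = n →
      sqVol A T ≤ (((n : ℝ) + 1) / ((n : ℝ) - (r : ℝ) + 1)) ^ r * sqVol A I := by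
  intro T hT
  have hpsd := posSemidef_conjTranspose_mul_self (rowsSub A I)
  obtain ⟨B, hB⟩ := CStarAlgebra.nonneg_iff_eq_star_mul_self.mp hpsd.nonneg
  rw [star_eq_conjTranspose] at hB
  have hBdet : IsUnit B.det := by
    refine isUnit_iff_ne_zero.mpr fun h => hvol ?_
    rw [sqVol, hB, det_mul, h, mul_zero, Complex.zero_re]
  have hG : (rowsSub (A * B⁻¹) I)ᴴ * rowsSub (A * B⁻¹) I = 1 := by
    rw [rowsSub_mul, conjTranspose_mul, Matrix.mul_assoc, ← Matrix.mul_assoc _ _ B⁻¹, hB,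
      Matrix.mul_assoc, mul_nonsing_inv B hBdet, Matrix.mul_one, ← conjTranspose_mul,
      mul_nonsing_inv B hBdet, conjTranspose_one]
  have hc : 0 < Complex.normSq (B⁻¹).det :=
    Complex.normSq_pos.mpr (isUnit_nonsing_inv_det B hBdet).ne_zero
  have hloc' : ∀ j ∈ I, ∀ i ∉ I,
      sqVol (A * B⁻¹) (insert i (I.erase j)) ≤ sqVol (A * B⁻¹) I := fun j hj i hi => by
    rw [sqVol_mul, sqVol_mul]
    exact mul_le_mul_of_nonneg_left (hloc j hj i hi) hc.le
  refine le_of_mul_le_mul_left ?_ hc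
  rw [mul_left_comm, ← sqVol_mul, ← sqVol_mul, sqVol_eq_one hG, mul_one]
  have hr' : (0 : ℝ) < r := by exact_mod_cast hr
  refine ((posSemidef_conjTranspose_mul_self _).re_det_le (by omega)).trans ?_
  rw [re_trace_conjTranspose_mul_rowsSub]
  refine pow_le_pow_left₀ (div_nonneg (Finset.sum_nonneg fun k _ => sqRowNorm_nonneg _ k) hr'.le)
    ?_ r
  rw [div_le_iff₀' hr']
  exact sum_sqRowNorm_le hrn hI hG hloc' hT
end

section
/- Let r, n, N be natural numbers with 1 ≤ r ≤ n < N and n ≥ r²/2 + r − 1, and let A be an N × r complex matrix. Suppose I is a set of n row indices such that the submatrix A_I has nonzero volume and has locally maximal volume with respect to single-row exchanges, i.e. for every j ∈ I and every i ∉ I one has V(A_{(I\{j})∪{i}}) ≤ V(A_I). Then for every set T of n row indices, V(A_T) ≤ V(A_I) · (1 + 2/r)^{r/2}, and in particular V(A_T) ≤ e · V(A_I), where e is Euler's number. -/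
open Matrix BigOperators

/-- The volume `√(det(BᴴB))` of the row submatrix `A_S`. -/
noncomputable def vol {N r : ℕ} (A : Matrix (Fin N) (Fin r) ℂ) (S : Finset (Fin N)) : ℝ :=
  Real.sqrt ((((rowsSub A S)ᴴ * rowsSub A S).det).re)

/-- The Gram matrix `BᴴB` of the row submatrix `B = A_S`. -/
def rowGram {N r : ℕ} (A : Matrix (Fin N) (Fin r) ℂ) (S : Finset (Fin N)) :
    Matrix (Fin r) (Fin r) ℂ :=
  (rowsSub A S)ᴴ * rowsSub A S

/-- The squared Euclidean norm of the `i`-th row. -/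
def rowNormSq {N r : ℕ} (A : Matrix (Fin N) (Fin r) ℂ) (i : Fin N) : ℝ :=
  ∑ k, Complex.normSq (A i k)

lemma rowNormSq_nonneg {N r : ℕ} (A : Matrix (Fin N) (Fin r) ℂ) (i : Fin N) :
    0 ≤ rowNormSq A i :=
  Finset.sum_nonneg fun _ _ => Complex.normSq_nonneg _

lemma dotProduct_star_row {N r : ℕ} (A : Matrix (Fin N) (Fin r) ℂ) (i : Fin N) :
    A i ⬝ᵥ star (A i) = rowNormSq A i := by
  simp [dotProduct, rowNormSq, Complex.mul_conj]

lemma rowGram_eq_sum {N r : ℕ} (A : Matrix (Fin N) (Fin r) ℂ) (S : Finset (Fin N)) :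
    rowGram A S = ∑ i ∈ S, vecMulVec (star (A i)) (A i) := by
  ext a b
  simp only [rowGram, rowsSub, mul_apply, conjTranspose_apply, submatrix_apply, id, Matrix.sum_apply,
    vecMulVec_apply, Pi.star_apply]
  exact Finset.sum_coe_sort S fun x => star (A x a) * A x b

open scoped ComplexOrder in
lemma posSemidef_rowGram {N r : ℕ} (A : Matrix (Fin N) (Fin r) ℂ) (S : Finset (Fin N)) :
    (rowGram A S).PosSemidef :=
  posSemidef_conjTranspose_mul_self _

open scoped ComplexOrder in
lemma det_rowGram_re_nonneg {N r : ℕ} (A : Matrix (Fin N) (Fin r) ℂ) (S : Finset (Fin N)) :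
    0 ≤ (rowGram A S).det.re :=
  (Complex.nonneg_iff.mp (posSemidef_rowGram A S).det_nonneg).1

lemma rowGram_mul {N r : ℕ} (A : Matrix (Fin N) (Fin r) ℂ) (B : Matrix (Fin r) (Fin r) ℂ)
    (S : Finset (Fin N)) : rowGram (A * B) S = Bᴴ * rowGram A S * B := by
  have h : rowsSub (A * B) S = rowsSub A S * B := by
    ext a b
    simp [rowsSub, mul_apply]
  simp only [rowGram, h, conjTranspose_mul, Matrix.mul_assoc]

lemma vol_mul {N r : ℕ} (A : Matrix (Fin N) (Fin r) ℂ) (B : Matrix (Fin r) (Fin r) ℂ)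
    (S : Finset (Fin N)) : vol (A * B) S = ‖B.det‖ * vol A S := by
  change √((rowGram (A * B) S).det.re) = ‖B.det‖ * √((rowGram A S).det.re)
  have h : (rowGram (A * B) S).det = (‖B.det‖ ^ 2 : ℝ) * (rowGram A S).det := by
    rw [rowGram_mul, det_mul, det_mul, det_conjTranspose, mul_right_comm]
    congr 1
    simp [Complex.conj_mul']
  rw [h, Complex.re_ofReal_mul, Real.sqrt_mul (sq_nonneg _), Real.sqrt_sq (norm_nonneg _)]

lemma trace_rowGram {N r : ℕ} (A : Matrix (Fin N) (Fin r) ℂ) (S : Finset (Fin N)) :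
    (rowGram A S).trace = (∑ i ∈ S, rowNormSq A i : ℝ) := by
  rw [rowGram_eq_sum, trace_sum, Complex.ofReal_sum]
  refine Finset.sum_congr rfl fun i _ => ?_
  rw [trace_vecMulVec, dotProduct_comm, dotProduct_star_row]

open scoped ComplexOrder in
/-- The arithmetic-geometric mean inequality for the eigenvalues of a positive semidefinite
matrix. -/
lemma Matrix.PosSemidef.det_re_le_trace_div_pow {r : ℕ} (hr : 1 ≤ r)
    {M : Matrix (Fin r) (Fin r) ℂ} (hM : M.PosSemidef) :
    M.det.re ≤ (M.trace.re / r) ^ r := by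
  have hr0 : (0 : ℝ) < r := by exact_mod_cast hr
  have hd : M.det.re = ∏ i, hM.isHermitian.eigenvalues i := by
    rw [hM.isHermitian.det_eq_prod_eigenvalues]
    norm_cast
  have ht : M.trace.re = ∑ i, hM.isHermitian.eigenvalues i := by
    rw [hM.isHermitian.trace_eq_sum_eigenvalues]
    norm_cast
  have h := Real.geom_mean_le_arith_mean Finset.univ (fun _ => (1 : ℝ))
    hM.isHermitian.eigenvalues (by simp) (by simpa using hr0)
    (fun i _ => hM.eigenvalues_nonneg i)
  simp only [Real.rpow_one, one_mul, Finset.sum_const, Finset.card_univ, Fintype.card_fin,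
    nsmul_eq_mul, mul_one] at h
  rw [← hd, ← ht] at h
  have h0 : 0 ≤ M.det.re := (Complex.nonneg_iff.mp hM.det_nonneg).1
  calc M.det.re = (M.det.re ^ (r : ℝ)⁻¹) ^ r := (Real.rpow_inv_natCast_pow h0 (by omega)).symm
    _ ≤ _ := pow_le_pow_left₀ (Real.rpow_nonneg h0 _) h r

/-- The rank-two update formula for the determinant of a normalized Gram matrix. -/
lemma det_rowGram_exchange {N r : ℕ} {A : Matrix (Fin N) (Fin r) ℂ} {I : Finset (Fin N)}
    (hG : rowGram A I = 1) {i j : Fin N} (hj : j ∈ I) (hi : i ∉ I) :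
    (rowGram A (insert i (I.erase j))).det.re =
      (1 + rowNormSq A i) * (1 - rowNormSq A j) + Complex.normSq (A i ⬝ᵥ star (A j)) := by
  have hup : rowGram A (insert i (I.erase j)) =
      1 + (of ![star (A i), -star (A j)])ᵀ * of ![A i, A j] := by
    rw [← hG, rowGram_eq_sum, rowGram_eq_sum, Finset.sum_insert (by simp [hi]),
      ← Finset.add_sum_erase I _ hj]
    ext a b
    simp [mul_apply, Fin.sum_univ_two, vecMulVec_apply]
    ring
  have hent : of ![A i, A j] * (of ![star (A i), -star (A j)])ᵀ =
      !![(rowNormSq A i : ℂ), -(A i ⬝ᵥ star (A j));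
        star (A i ⬝ᵥ star (A j)), -(rowNormSq A j : ℂ)] := by
    have hs : star (A i ⬝ᵥ star (A j)) = A j ⬝ᵥ star (A i) := by
      rw [← star_dotProduct_star, star_star]
    rw [hs, ← dotProduct_star_row, ← dotProduct_star_row]
    ext a b
    fin_cases a <;> fin_cases b <;> simp [mul_apply, dotProduct]
  rw [hup, det_one_add_mul_comm, hent, det_fin_two]
  simp [Complex.mul_conj, sub_eq_add_neg]

lemma sum_normSq_dotProduct {N r : ℕ} {A : Matrix (Fin N) (Fin r) ℂ} {I : Finset (Fin N)}
    (hG : rowGram A I = 1) (i : Fin N) :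
    ∑ j ∈ I, Complex.normSq (A i ⬝ᵥ star (A j)) = rowNormSq A i := by
  have h : A i ⬝ᵥ (rowGram A I *ᵥ star (A i)) = rowNormSq A i := by
    rw [hG, one_mulVec, dotProduct_star_row]
  rw [rowGram_eq_sum, sum_mulVec, dotProduct_sum] at h
  rw [← Complex.ofReal_inj, ← h, Complex.ofReal_sum]
  refine Finset.sum_congr rfl fun j _ => ?_
  have hs : A j ⬝ᵥ star (A i) = star (A i ⬝ᵥ star (A j)) := by
    rw [← star_dotProduct_star, star_star]
  rw [vecMulVec_mulVec, hs, op_smul_eq_smul, dotProduct_smul, smul_eq_mul, mul_comm]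
  exact (Complex.mul_conj _).symm

/-- A locally maximal normalized `I` bounds the trace of the Gram matrix of every other row
set of the same cardinality. -/
lemma sum_rowNormSq_le {N r : ℕ} {A : Matrix (Fin N) (Fin r) ℂ} {I T : Finset (Fin N)}
    (hrI : r ≤ I.card) (hn : (r : ℝ) ^ 2 / 2 + (r : ℝ) - 1 ≤ (I.card : ℝ))
    (hcard : T.card = I.card) (hG : rowGram A I = 1)
    (hloc : ∀ j ∈ I, ∀ i ∉ I, (rowGram A (insert i (I.erase j))).det.re ≤ 1) :
    ∑ i ∈ T, rowNormSq A i ≤ r + 2 := by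
  have hsum : ∑ j ∈ I, rowNormSq A j = r := by
    have h := trace_rowGram A I
    rw [hG, trace_one, Fintype.card_fin] at h
    exact_mod_cast h.symm
  have hex : ∀ j ∈ I, ∀ i ∉ I, (1 + rowNormSq A i) * (1 - rowNormSq A j) +
      Complex.normSq (A i ⬝ᵥ star (A j)) ≤ 1 := fun j hj i hi =>
    det_rowGram_exchange hG hj hi ▸ hloc j hj i hi
  have hd : (0 : ℝ) < I.card - r + 1 := by
    have : (r : ℝ) ≤ I.card := by exact_mod_cast hrI
    linarith
  have hout : ∀ i ∉ I, rowNormSq A i ≤ r / (I.card - r + 1) := by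
    intro i hi
    have h := Finset.sum_le_sum fun j hj => hex j hj i hi
    rw [Finset.sum_add_distrib, ← Finset.mul_sum, Finset.sum_sub_distrib, hsum,
      sum_normSq_dotProduct hG] at h
    simp only [Finset.sum_const, nsmul_eq_mul, mul_one] at h
    rw [le_div_iff₀ hd]
    linarith
  have hpair : ∀ j ∈ I, ∀ i ∉ I,
      rowNormSq A i ≤ rowNormSq A j * (1 + r / (I.card - r + 1)) := by
    intro j hj i hi
    have h := hex j hj i hi
    have h1 := Complex.normSq_nonneg (A i ⬝ᵥ star (A j))
    have h2 := mul_le_mul_of_nonneg_left (hout i hi) (rowNormSq_nonneg A j)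
    linarith
  have hc : (T \ I).card = (I \ T).card :=
    Finset.card_sdiff_comm hcard
  have hdiff : ∑ i ∈ T \ I, rowNormSq A i ≤
      ∑ j ∈ I \ T, rowNormSq A j * (1 + r / (I.card - r + 1)) := by
    let e := Finset.equivOfCardEq hc
    rw [← Finset.sum_coe_sort (T \ I), ← Finset.sum_coe_sort (I \ T), ← e.sum_comp]
    exact Finset.sum_le_sum fun i _ => hpair _ (Finset.mem_sdiff.mp (e i).2).1 _
      (Finset.mem_sdiff.mp i.2).2
  have hp : ∑ j ∈ I \ T, rowNormSq A j ≤ r :=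
    hsum ▸ Finset.sum_le_sum_of_subset_of_nonneg Finset.sdiff_subset
      fun j _ _ => rowNormSq_nonneg A j
  have hq : (r : ℝ) * (r / (I.card - r + 1)) ≤ 2 := by
    rw [← mul_div_assoc, div_le_iff₀ hd]
    linarith
  have hq0 : (0 : ℝ) ≤ r / (I.card - r + 1) := by positivity
  have hpq := mul_le_mul_of_nonneg_right hp hq0
  rw [← Finset.sum_mul] at hdiff
  have hT := Finset.sum_inter_add_sum_sdiff T I (rowNormSq A)
  have hI := Finset.sum_inter_add_sum_sdiff I T (rowNormSq A)
  rw [Finset.inter_comm] at hI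
  linarith

open scoped ComplexOrder MatrixOrder Matrix.Norms.L2Operator in
lemma exists_rowGram_mul_eq_one {N r : ℕ} {A : Matrix (Fin N) (Fin r) ℂ}
    {I : Finset (Fin N)} (h : (rowGram A I).det ≠ 0) :
    ∃ B : Matrix (Fin r) (Fin r) ℂ, B.det ≠ 0 ∧ rowGram (A * B) I = 1 := by
  obtain ⟨B, hB⟩ := CStarAlgebra.nonneg_iff_eq_star_mul_self.mp (posSemidef_rowGram A I).nonneg
  rw [star_eq_conjTranspose] at hB
  have hdet : IsUnit B.det := by
    rw [isUnit_iff_ne_zero]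
    rintro h0
    simp [hB, h0] at h
  refine ⟨B⁻¹, (isUnit_nonsing_inv_det B hdet).ne_zero, ?_⟩
  rw [rowGram_mul, hB, Matrix.mul_assoc, Matrix.mul_assoc, mul_nonsing_inv B hdet, Matrix.mul_one,
    ← conjTranspose_mul, mul_nonsing_inv B hdet, conjTranspose_one]

/-- If `1 ≤ r ≤ n < N`, `n ≥ r²/2 + r - 1`, and `A_I` is an `n × r` row submatrix of nonzero
volume with locally maximal volume with respect to single-row exchanges, then the volume of
any `n × r` row submatrix is at most `(1 + 2/r)^{r/2} ≤ e` times the volume of `A_I`. -/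
theorem statement1 (r n N : ℕ) (hr : 1 ≤ r) (hrn : r ≤ n) (hnN : n < N)
    (hn : (r : ℝ) ^ 2 / 2 + (r : ℝ) - 1 ≤ (n : ℝ))
    (A : Matrix (Fin N) (Fin r) ℂ) (I : Finset (Fin N)) (hI : I.card = n)
    (hvol : vol A I ≠ 0)
    (hloc : ∀ j ∈ I, ∀ i ∉ I, vol A (insert i (I.erase j)) ≤ vol A I) :
    ∀ T : Finset (Fin N), T.card = n →
      vol A T ≤ (1 + 2 / (r : ℝ)) ^ ((r : ℝ) / 2) * vol A I ∧
      vol A T ≤ Real.exp 1 * vol A I := by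
  intro T hT
  have hr0 : (0 : ℝ) < r := by exact_mod_cast hr
  have hdet : (rowGram A I).det ≠ 0 := by
    intro h
    apply hvol
    change √((rowGram A I).det.re) = 0
    simp [h]
  obtain ⟨B, hB, hG⟩ := exists_rowGram_mul_eq_one hdet
  have hB0 : 0 < ‖B.det‖ := norm_pos_iff.mpr hB
  have hvolI : vol (A * B) I = 1 := by
    change √((rowGram (A * B) I).det.re) = 1
    simp [hG]
  have hloc' : ∀ j ∈ I, ∀ i ∉ I, (rowGram (A * B) (insert i (I.erase j))).det.re ≤ 1 := by
    intro j hj i hi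
    have h := mul_le_mul_of_nonneg_left (hloc j hj i hi) hB0.le
    rw [← vol_mul, ← vol_mul, hvolI] at h
    exact Real.sqrt_le_one.mp h
  have htr := sum_rowNormSq_le (T := T) (hI ▸ hrn) (hI ▸ hn) (hT.trans hI.symm) hG hloc'
  have hdetT : (rowGram (A * B) T).det.re ≤ (1 + 2 / (r : ℝ)) ^ r := by
    refine ((posSemidef_rowGram _ T).det_re_le_trace_div_pow hr).trans ?_
    rw [trace_rowGram, Complex.ofReal_re]
    refine pow_le_pow_left₀ (div_nonneg (Finset.sum_nonneg fun i _ => rowNormSq_nonneg _ i)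
      hr0.le) ?_ r
    rw [div_le_iff₀ hr0, add_mul, div_mul_cancel₀ _ hr0.ne', one_mul]
    exact htr
  have hmain : vol A T ≤ (1 + 2 / (r : ℝ)) ^ ((r : ℝ) / 2) * vol A I := by
    refine le_of_mul_le_mul_left ?_ hB0
    rw [mul_left_comm, ← vol_mul, ← vol_mul, hvolI, mul_one]
    refine (Real.sqrt_le_sqrt hdetT).trans_eq ?_
    rw [Real.sqrt_eq_rpow, ← Real.rpow_natCast, ← Real.rpow_mul (by positivity)]
    ring_nf
  refine ⟨hmain, hmain.trans (mul_le_mul_of_nonneg_right ?_ (Real.sqrt_nonneg _))⟩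
  calc (1 + 2 / (r : ℝ)) ^ ((r : ℝ) / 2) ≤ Real.exp (2 / r) ^ ((r : ℝ) / 2) := by
        refine Real.rpow_le_rpow (by positivity) ?_ (by positivity)
        linarith [Real.add_one_le_exp (2 / (r : ℝ))]
    _ = Real.exp 1 := by
        rw [← Real.exp_mul]
        congr 1
        field_simp
end

section
/- Let A be an N × r complex matrix, let c ≥ 1, and let r ≤ n ≤ N. Let S_r be a set of r row indices such that for every set T of r row indices, |det(A_T)|² ≤ c^{2r} r^r · |det(A_{S_r})|² (i.e., the volume of A_{S_r} is within a factor Γ = c^r r^{r/2} of the maximal volume among all r × r submatrices). Let S_r ⊂ S_{r+1} ⊂ ⋯ ⊂ S_n be a chain of sets of row indices with |S_k| = k, chosen greedily to maximize volume at each step: S_{k+1} = S_k ∪ {i_{k+1}} with i_{k+1} ∉ S_k, and for every j ∉ S_k, det((A_{S_k∪{i_{k+1}}})ᴴ A_{S_k∪{i_{k+1}}}) ≥ det((A_{S_k∪{j}})ᴴ A_{S_k∪{j}}). Then for every set T of n row indices, det((A_T)ᴴ A_T) ≤ max((e·n/r)^r, (c²·r)^r) · det((A_{S_n})ᴴ A_{S_n}),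 where e is Euler's number. -/
open Matrix BigOperators

open scoped ComplexOrder

/-- The quadratic form `v ↦ vᴴ M⁻¹ v` of the inverse of a matrix (the leverage score of the row
`vᴴ` when `M` is a Gram matrix). -/
noncomputable def leverage {r : ℕ} (M : Matrix (Fin r) (Fin r) ℂ) (v : Fin r → ℂ) : ℝ :=
  (star v ⬝ᵥ M⁻¹ *ᵥ v).re

theorem prod_le_arith_mean_pow {r : ℕ} (z : Fin r → ℝ) (hz : ∀ i, 0 ≤ z i) :
    ∏ i, z i ≤ ((∑ i, z i) / r) ^ r := by
  rcases Nat.eq_zero_or_pos r with rfl | hr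
  · simp
  have hr' : (0 : ℝ) < r := by exact_mod_cast hr
  have h := Real.geom_mean_le_arith_mean Finset.univ (fun _ => 1) z (fun _ _ => zero_le_one)
    (by simpa using hr') (fun i _ => hz i)
  simp only [Real.rpow_one, one_mul, Finset.sum_const, Finset.card_univ, Fintype.card_fin,
    nsmul_eq_mul, mul_one] at h
  have hp : 0 ≤ ∏ i, z i := Finset.prod_nonneg fun i _ => hz i
  calc ∏ i, z i = ((∏ i, z i) ^ (r : ℝ)⁻¹) ^ r := by
        rw [Real.rpow_inv_natCast_pow hp hr.ne']
    _ ≤ _ := pow_le_pow_left₀ (by positivity) h r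

theorem Matrix.PosSemidef.det_re_le_trace_pow {r : ℕ} {P : Matrix (Fin r) (Fin r) ℂ}
    (hP : P.PosSemidef) : P.det.re ≤ (P.trace.re / r) ^ r := by
  have h := prod_le_arith_mean_pow _ hP.eigenvalues_nonneg
  rw [hP.1.det_eq_prod_eigenvalues, hP.1.trace_eq_sum_eigenvalues]
  simpa [← Complex.ofReal_prod, ← Complex.ofReal_sum] using h

theorem Matrix.PosSemidef.ofReal_det_re {r : ℕ} {P : Matrix (Fin r) (Fin r) ℂ}
    (hP : P.PosSemidef) : ((P.det.re : ℝ) : ℂ) = P.det :=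
  (Complex.eq_re_of_ofReal_le (r := 0) (by simpa using hP.det_nonneg)).symm

open scoped MatrixOrder in
theorem Matrix.PosDef.det_re_le {r : ℕ} {M P : Matrix (Fin r) (Fin r) ℂ}
    (hM : M.PosDef) (hP : P.PosSemidef) :
    P.det.re ≤ ((M⁻¹ * P).trace.re / r) ^ r * M.det.re := by
  obtain ⟨B, hB⟩ := CStarAlgebra.nonneg_iff_eq_star_mul_self.mp hM.inv.posSemidef.nonneg
  rw [star_eq_conjTranspose] at hB
  have h := (hP.mul_mul_conjTranspose_same B).det_re_le_trace_pow
  rw [Matrix.trace_mul_comm, ← Matrix.mul_assoc, ← hB] at h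
  have hMpos : 0 < M.det.re := (Complex.pos_iff.mp hM.det_pos).1
  have hdet : (B * P * Bᴴ).det * M.det = P.det := by
    have h1 : (B * P * Bᴴ).det = M⁻¹.det * P.det := by
      rw [hB]; simp only [Matrix.det_mul]; ring
    rw [h1, mul_right_comm, ← Matrix.det_mul, Matrix.nonsing_inv_mul _ hM.det_pos.ne'.isUnit,
      Matrix.det_one, one_mul]
  have hre : (B * P * Bᴴ).det.re * M.det.re = P.det.re := by
    rw [← hdet, ← hM.posSemidef.ofReal_det_re, Complex.re_mul_ofReal, Complex.ofReal_re]
  rw [← hre]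
  exact mul_le_mul_of_nonneg_right h hMpos.le

theorem Matrix.PosDef.ofReal_leverage {r : ℕ} {M : Matrix (Fin r) (Fin r) ℂ} (hM : M.PosDef)
    (v : Fin r → ℂ) : ((leverage M v : ℝ) : ℂ) = star v ⬝ᵥ M⁻¹ *ᵥ v :=
  (Complex.eq_re_of_ofReal_le (r := 0)
    (by simpa using hM.inv.posSemidef.dotProduct_mulVec_nonneg v)).symm

theorem Matrix.PosDef.leverage_nonneg {r : ℕ} {M : Matrix (Fin r) (Fin r) ℂ} (hM : M.PosDef)
    (v : Fin r → ℂ) : 0 ≤ leverage M v :=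
  hM.inv.posSemidef.re_dotProduct_nonneg v

theorem det_add_smul_vecMulVec {r : ℕ} {M : Matrix (Fin r) (Fin r) ℂ} (hM : IsUnit M.det)
    (a : ℂ) (v w : Fin r → ℂ) :
    (M + a • vecMulVec v w).det = M.det * (1 + a * (w ⬝ᵥ M⁻¹ *ᵥ v)) := by
  have h := Matrix.det_add_replicateCol_mul_replicateRow (ι := Unit) hM (a • v) w
  rw [← smul_vecMulVec, vecMulVec_eq Unit, h, Matrix.det_unique (n := Unit)]
  congr 1
  rw [Matrix.add_apply, Matrix.one_apply_eq, Matrix.mul_assoc, ← Matrix.replicateCol_mulVec,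
    Matrix.replicateRow_mul_replicateCol_apply, Matrix.mulVec_smul, dotProduct_smul, smul_eq_mul]

theorem Matrix.PosDef.det_add_re {r : ℕ} {M : Matrix (Fin r) (Fin r) ℂ} (hM : M.PosDef)
    (a : ℝ) (v : Fin r → ℂ) :
    (M + (a : ℂ) • vecMulVec v (star v)).det.re = M.det.re * (1 + a * leverage M v) := by
  rw [det_add_smul_vecMulVec hM.det_pos.ne'.isUnit, ← hM.ofReal_leverage]
  rw [← hM.posSemidef.ofReal_det_re]
  norm_cast

theorem leverage_anti {r : ℕ} {M P : Matrix (Fin r) (Fin r) ℂ} (hM : M.PosDef)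
    (hP : P.PosSemidef) (v : Fin r → ℂ) : leverage (M + P) v ≤ leverage M v := by
  have hMP := hM.add_posSemidef hP
  set z := (M + P)⁻¹ *ᵥ v with hz
  set w := M⁻¹ *ᵥ v with hw
  have hzv : (M + P) *ᵥ z = v := by
    rw [hz, Matrix.mulVec_mulVec, Matrix.mul_nonsing_inv _ hMP.det_pos.ne'.isUnit,
      Matrix.one_mulVec]
  have hwv : M *ᵥ w = v := by
    rw [hw, Matrix.mulVec_mulVec, Matrix.mul_nonsing_inv _ hM.det_pos.ne'.isUnit,
      Matrix.one_mulVec]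
  have h1 : 0 ≤ (star (z - w) ⬝ᵥ M *ᵥ (z - w)).re :=
    hM.posSemidef.re_dotProduct_nonneg (z - w)
  have h2 : 0 ≤ (star z ⬝ᵥ P *ᵥ z).re := hP.re_dotProduct_nonneg z
  have h3 : star z ⬝ᵥ M *ᵥ z + star z ⬝ᵥ P *ᵥ z = star z ⬝ᵥ v := by
    rw [← dotProduct_add, ← Matrix.add_mulVec, hzv]
  have h4 : star w ⬝ᵥ M *ᵥ z = star v ⬝ᵥ z := by
    rw [← congrArg star hwv, star_mulVec M w, hM.1.eq, dotProduct_mulVec]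
  have h5 : ∀ u : Fin r → ℂ, (star u ⬝ᵥ v).re = (star v ⬝ᵥ u).re := fun u => by
    rw [star_dotProduct]; simp
  have h6 : star (z - w) ⬝ᵥ M *ᵥ (z - w)
      = star z ⬝ᵥ M *ᵥ z - star v ⬝ᵥ z - star z ⬝ᵥ v + star w ⬝ᵥ v := by
    rw [star_sub, sub_dotProduct, Matrix.mulVec_sub, dotProduct_sub, dotProduct_sub, h4, hwv]
    ring
  rw [h6] at h1
  have h3' := congrArg Complex.re h3
  simp only [Complex.add_re, Complex.sub_re, h5] at h1 h3'
  change (star v ⬝ᵥ z).re ≤ (star v ⬝ᵥ w).re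
  linarith

/-- The Gram matrix `∑ⱼ vⱼ vⱼᴴ` over `j ∈ S`. -/
noncomputable def gramSum {ι : Type*} {r : ℕ} (v : ι → Fin r → ℂ) (S : Finset ι) :
    Matrix (Fin r) (Fin r) ℂ :=
  ∑ j ∈ S, vecMulVec (v j) (star (v j))

section gramSum

variable {ι : Type*} {r : ℕ} (v : ι → Fin r → ℂ)

theorem gramSum_posSemidef (S : Finset ι) : (gramSum v S).PosSemidef :=
  Matrix.posSemidef_sum S fun j _ => Matrix.posSemidef_vecMulVec_self_star (v j)

theorem gramSum_det_re_nonneg (S : Finset ι) : 0 ≤ (gramSum v S).det.re :=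
  (Complex.nonneg_iff.mp (gramSum_posSemidef v S).det_nonneg).1

theorem gramSum_posDef {S : Finset ι} (h : (gramSum v S).det.re ≠ 0) : (gramSum v S).PosDef :=
  (gramSum_posSemidef v S).posDef_iff_det_ne_zero.mpr fun h0 => h (by rw [h0, Complex.zero_re])

theorem sum_leverage_eq_trace (M : Matrix (Fin r) (Fin r) ℂ) (T : Finset ι) :
    ∑ j ∈ T, leverage M (v j) = (M⁻¹ * gramSum v T).trace.re := by
  simp only [gramSum, leverage, Finset.mul_sum, Matrix.trace_sum, Complex.re_sum,
    Matrix.mul_vecMulVec, Matrix.trace_vecMulVec]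
  exact Finset.sum_congr rfl fun j _ => by rw [dotProduct_comm]

theorem sum_leverage_self {S : Finset ι} (hS : (gramSum v S).PosDef) :
    ∑ j ∈ S, leverage (gramSum v S) (v j) = r := by
  rw [sum_leverage_eq_trace, Matrix.nonsing_inv_mul _ hS.det_pos.ne'.isUnit]
  simp

theorem gramSum_det_le {S T : Finset ι} (hS : (gramSum v S).PosDef) {x : ℝ}
    (hx : ∀ j ∈ T, leverage (gramSum v S) (v j) ≤ x) :
    (gramSum v T).det.re ≤ (T.card * x / r) ^ r * (gramSum v S).det.re := by
  refine (hS.det_re_le (gramSum_posSemidef v T)).trans ?_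
  rw [← sum_leverage_eq_trace]
  have h0 : 0 ≤ ∑ j ∈ T, leverage (gramSum v S) (v j) :=
    Finset.sum_nonneg fun j _ => hS.leverage_nonneg _
  have h1 : ∑ j ∈ T, leverage (gramSum v S) (v j) ≤ T.card * x := by
    simpa using Finset.sum_le_card_nsmul T _ x hx
  gcongr
  exact gramSum_det_re_nonneg v S

variable [DecidableEq ι]

theorem gramSum_insert_det {S : Finset ι} (hS : (gramSum v S).PosDef) {j : ι} (hj : j ∉ S) :
    (gramSum v (insert j S)).det.re
      = (gramSum v S).det.re * (1 + leverage (gramSum v S) (v j)) := by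
  have h := hS.det_add_re 1 (v j)
  rw [one_mul, Complex.ofReal_one, one_smul] at h
  rw [← h, gramSum, Finset.sum_insert hj, add_comm, ← gramSum]

theorem gramSum_erase_det {S : Finset ι} (hS : (gramSum v S).PosDef) {j : ι} (hj : j ∈ S) :
    (gramSum v (S.erase j)).det.re
      = (gramSum v S).det.re * (1 - leverage (gramSum v S) (v j)) := by
  have h := hS.det_add_re (-1) (v j)
  rw [neg_one_mul, ← sub_eq_add_neg] at h
  rw [← h]
  congr 2
  simp only [gramSum, ← Finset.sum_erase_add S _ hj]
  simp

theorem leverage_le_one {S : Finset ι} (hS : (gramSum v S).PosDef) {j : ι} (hj : j ∈ S) :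
    leverage (gramSum v S) (v j) ≤ 1 := by
  have h := gramSum_det_re_nonneg v (S.erase j)
  rw [gramSum_erase_det v hS hj] at h
  have := nonneg_of_mul_nonneg_right h (Complex.pos_iff.mp hS.det_pos).1
  linarith

theorem leverage_gramSum_anti {S T : Finset ι} (hS : (gramSum v S).PosDef) (hST : S ⊆ T)
    (w : Fin r → ℂ) : leverage (gramSum v T) w ≤ leverage (gramSum v S) w := by
  have h : gramSum v T = gramSum v S + gramSum v (T \ S) := by
    rw [add_comm]
    exact (Finset.sum_sdiff hST).symm
  rw [h]
  exact leverage_anti hS (gramSum_posSemidef v _) w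

/-- A consequence of the Cauchy–Binet formula: the squared volume is at most the number of maximal
square submatrices times a bound for their squared volumes. -/
theorem gramSum_det_le_choose_mul {C : ℝ}
    (hC : ∀ R : Finset ι, R.card = r → (gramSum v R).det.re ≤ C) (m : ℕ) :
    ∀ T : Finset ι, T.card = r + m → (gramSum v T).det.re ≤ (r + m).choose r * C := by
  induction m with
  | zero => intro T hT; simpa using hC T hT
  | succ m ih =>
    intro T hT
    have hrec : ((r + m + 1).choose r : ℝ) * (m + 1) = (r + m).choose r * (r + m + 1) := by
      have := Nat.choose_mul_succ_eq (r + m) r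
      rw [show r + m + 1 - r = m + 1 by omega] at this
      exact_mod_cast this.symm
    have hcard : ∀ j ∈ T, (T.erase j).card = r + m := fun j hj => by
      rw [Finset.card_erase_of_mem hj, hT]; rfl
    by_cases h0 : (gramSum v T).det.re = 0
    · obtain ⟨j, hj⟩ : T.Nonempty := Finset.card_pos.mp (by omega)
      have hpos : 0 ≤ ((r + m).choose r : ℝ) * C :=
        (gramSum_det_re_nonneg v _).trans (ih _ (hcard j hj))
      have hch : (0 : ℝ) < (r + m).choose r := by
        exact_mod_cast Nat.choose_pos (Nat.le_add_right r m)
      rw [h0]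
      exact mul_nonneg (Nat.cast_nonneg _) (nonneg_of_mul_nonneg_right hpos hch)
    · have hT' := gramSum_posDef v h0
      have hsum : ∑ j ∈ T, (gramSum v (T.erase j)).det.re = (gramSum v T).det.re * (m + 1) := by
        rw [Finset.sum_congr rfl fun j hj => gramSum_erase_det v hT' hj, ← Finset.mul_sum,
          Finset.sum_sub_distrib, sum_leverage_self v hT', Finset.sum_const, hT]
        push_cast [nsmul_eq_mul]
        ring
      have hle : ∑ j ∈ T, (gramSum v (T.erase j)).det.re
          ≤ (r + m + 1) * ((r + m).choose r * C) := by
        refine (Finset.sum_le_card_nsmul T _ _ fun j hj => ih _ (hcard j hj)).trans_eq ?_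
        rw [hT]
        push_cast [nsmul_eq_mul]
        ring
      refine le_of_mul_le_mul_right ?_ (by positivity : (0 : ℝ) < m + 1)
      rw [← hsum]
      refine hle.trans_eq ?_
      rw [mul_right_comm, ← add_assoc, hrec]
      ring

end gramSum

theorem rowsSub_conjTranspose_mul_self {N r : ℕ} (A : Matrix (Fin N) (Fin r) ℂ)
    (S : Finset (Fin N)) :
    (rowsSub A S)ᴴ * rowsSub A S = gramSum (fun i => star (A i)) S := by
  ext p q
  simp only [Matrix.mul_apply, gramSum, Matrix.sum_apply, vecMulVec_apply, star_star, rowsSub,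
    Matrix.conjTranspose_apply, Matrix.submatrix_apply, id, Pi.star_apply]
  exact Finset.sum_coe_sort S fun i => star (A i p) * A i q

theorem choose_le_pow_mul_pow {r a : ℕ} {x : ℝ} (hx : 0 ≤ x) (h : (r : ℝ) ≤ x * (a + 1)) (b : ℕ)
    (hbase : ((r + a).choose r : ℝ) ≤ (1 + r : ℝ) ^ a) :
    ((r + (a + b)).choose r : ℝ) ≤ (1 + r : ℝ) ^ a * (1 + x) ^ b := by
  induction b with
  | zero => simpa using hbase
  | succ b ih =>
    have hrec : ((r + (a + b) + 1).choose r : ℝ) * (a + b + 1)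
        = (r + (a + b)).choose r * (r + (a + b) + 1) := by
      have := Nat.choose_mul_succ_eq (r + (a + b)) r
      rw [show r + (a + b) + 1 - r = a + b + 1 by omega] at this
      exact_mod_cast this.symm
    have hle : (r + (a + b) + 1 : ℝ) ≤ (1 + x) * (a + b + 1) := by
      nlinarith [mul_nonneg hx (Nat.cast_nonneg (α := ℝ) b)]
    have hpos : (0 : ℝ) < a + b + 1 := by positivity
    refine le_of_mul_le_mul_right ?_ hpos
    calc ((r + (a + (b + 1))).choose r : ℝ) * (a + b + 1)
        = (r + (a + b)).choose r * (r + (a + b) + 1) := hrec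
      _ ≤ ((1 + r : ℝ) ^ a * (1 + x) ^ b) * ((1 + x) * (a + b + 1)) := by gcongr
      _ = _ := by ring

theorem choose_add_le_pow (r a : ℕ) : ((r + a).choose r : ℝ) ≤ (1 + r : ℝ) ^ a := by
  have h := choose_le_pow_mul_pow (r := r) (a := 0) (x := r) (by positivity) (by simp) a (by simp)
  simpa using h

theorem one_add_div_pow_le_two_pow {r d : ℕ} (hr : 0 < r) (hrd : r ≤ d) :
    (1 + (d : ℝ) / r) ^ r ≤ 2 ^ d := by
  have hr' : (0 : ℝ) < r := by exact_mod_cast hr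
  have hs : (1 : ℝ) ≤ d / r := by
    rw [le_div_iff₀ hr', one_mul]; exact_mod_cast hrd
  have h := one_add_mul_self_le_rpow_one_add (s := 1) (by norm_num) hs
  calc (1 + (d : ℝ) / r) ^ r ≤ ((2 : ℝ) ^ ((d : ℝ) / r)) ^ r := by
        gcongr
        norm_num at h
        exact h
    _ = 2 ^ d := by
        rw [← Real.rpow_natCast, ← Real.rpow_mul (by norm_num), div_mul_cancel₀ _ hr'.ne',
          Real.rpow_natCast]

theorem one_add_div_pow_le {r a b : ℕ} {y : ℝ} (hr : 3 ≤ r) (hy : Real.exp 1 ≤ y)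
    (hab : a * r < a + b) :
    (1 + ((a + b : ℕ) : ℝ) / r) ^ r ≤ (1 + y) ^ b := by
  have hr' : (0 : ℝ) < r := by exact_mod_cast (by omega : 0 < r)
  have he := Real.exp_one_gt_d9
  rcases Nat.eq_zero_or_pos a with rfl | ha
  · calc (1 + ((0 + b : ℕ) : ℝ) / r) ^ r ≤ (Real.exp ((b : ℝ) / r)) ^ r := by
          gcongr
          rw [zero_add, add_comm]
          exact Real.add_one_le_exp _
      _ = Real.exp 1 ^ b := by
          rw [← Real.exp_nat_mul, mul_div_cancel₀ _ hr'.ne', ← Real.exp_nat_mul, mul_one]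
      _ ≤ (1 + y) ^ b := by gcongr; linarith
  · have hrd : r ≤ a + b := by nlinarith
    have h3 : 2 * (a + b) ≤ 3 * b := by nlinarith
    refine (one_add_div_pow_le_two_pow (by omega) hrd).trans ?_
    refine le_of_pow_le_pow_left₀ three_ne_zero (pow_nonneg (by linarith) _) ?_
    calc ((2 : ℝ) ^ (a + b)) ^ 3 = (8 : ℝ) ^ (a + b) := by
          rw [← pow_mul, mul_comm, pow_mul]; norm_num
      _ ≤ ((1 + y) ^ 2) ^ (a + b) := by gcongr; nlinarith
      _ = (1 + y) ^ (2 * (a + b)) := by rw [pow_mul]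
      _ ≤ (1 + y) ^ (3 * b) := pow_le_pow_right₀ (by linarith) h3
      _ = ((1 + y) ^ b) ^ 3 := by rw [mul_comm, pow_mul]

theorem one_add_pow_mul_le {V y : ℕ → ℝ} {t : ℝ} {d : ℕ} (hV : ∀ k ≤ d, 0 ≤ V k)
    (hstep : ∀ k < d, V (k + 1) = V k * (1 + y k)) (ht : 0 ≤ t) (k m : ℕ) (hkm : k + m ≤ d)
    (hy : ∀ j < k + m, k ≤ j → t ≤ y j) : (1 + t) ^ m * V k ≤ V (k + m) := by
  induction m with
  | zero => simp
  | succ m ih =>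
    have h1 := ih (by omega) fun j hj => hy j (by omega)
    have h2 := hy (k + m) (by omega) (by omega)
    have h3 := hV (k + m) (by omega)
    calc (1 + t) ^ (m + 1) * V k = (1 + t) ^ m * V k * (1 + t) := by ring
      _ ≤ V (k + m) * (1 + y (k + m)) := by gcongr
      _ = V (k + (m + 1)) := (hstep (k + m) (by omega)).symm

theorem le_pow_mul_of_greedy {r d : ℕ} (hr : 0 < r) {c x W : ℝ} (hc : 1 ≤ c) {V y : ℕ → ℝ}
    (hV : ∀ k ≤ d, 0 ≤ V k) (hstep : ∀ k < d, V (k + 1) = V k * (1 + y k))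
    (hx : Real.exp 1 ≤ x) (hxy : ∀ k < d, x ≤ y k)
    (hW0 : W ≤ (r + d).choose r * ((c ^ 2 * r) ^ r * V 0))
    (hW : ∀ k < d, W ≤ (((r + d : ℕ) : ℝ) * y k / r) ^ r * V k)
    (hxr : c ^ 2 * r ≤ ((r + d : ℕ) : ℝ) * x / r) :
    W ≤ (c ^ 2 * r) ^ r * V d := by
  have hr' : (0 : ℝ) < r := by exact_mod_cast hr
  have he := Real.exp_one_gt_d9
  have hx0 : 0 < x := by linarith
  have hcr : (r : ℝ) ≤ c ^ 2 * r := le_mul_of_one_le_left hr'.le (one_le_pow₀ hc)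
  obtain ⟨a, b, rfl, ha, hb⟩ : ∃ a b, d = a + b ∧ (∀ j < a, c ^ 2 * r ≤ y j) ∧
      (0 < b → y a ≤ c ^ 2 * r) := by
    classical
    have hex : ∃ k, k = d ∨ y k ≤ c ^ 2 * r := ⟨d, Or.inl rfl⟩
    have hle : Nat.find hex ≤ d := Nat.find_min' hex (Or.inl rfl)
    refine ⟨Nat.find hex, d - Nat.find hex, by omega, fun j hj => ?_, fun hpos => ?_⟩
    · have := Nat.find_min hex hj
      push Not at this
      exact this.2.le
    · exact (Nat.find_spec hex).resolve_left (by omega)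
  have hVa : (1 + (r : ℝ)) ^ a * V 0 ≤ V a := by
    have := one_add_pow_mul_le hV hstep hr'.le 0 a (by omega)
      fun j hj _ => hcr.trans (ha j (by omega))
    rwa [zero_add] at this
  have hVd : (1 + x) ^ b * V a ≤ V (a + b) :=
    one_add_pow_mul_le hV hstep hx0.le a b le_rfl fun j hj _ => hxy j hj
  have hV0 := hV 0 (by omega)
  rcases le_or_gt (r : ℝ) (x * (a + 1)) with h | h
  · calc W ≤ (r + (a + b)).choose r * ((c ^ 2 * r) ^ r * V 0) := hW0
      _ ≤ ((1 + r : ℝ) ^ a * (1 + x) ^ b) * ((c ^ 2 * r) ^ r * V 0) := by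
          gcongr
          exact choose_le_pow_mul_pow hx0.le h b (choose_add_le_pow r a)
      _ = (c ^ 2 * r) ^ r * ((1 + x) ^ b * ((1 + r : ℝ) ^ a * V 0)) := by ring
      _ ≤ (c ^ 2 * r) ^ r * ((1 + x) ^ b * V a) := by gcongr
      _ ≤ (c ^ 2 * r) ^ r * V (a + b) := by gcongr
  · have hr3 : 3 ≤ r := by
      have : (2 : ℝ) < r := by nlinarith [(Nat.cast_nonneg a : (0 : ℝ) ≤ a)]
      exact_mod_cast this
    have hab : a * r < a + b := by
      have h1 : (r : ℝ) * r ≤ ((r + (a + b) : ℕ) : ℝ) * x := by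
        rw [← le_div_iff₀ hr']; exact hcr.trans hxr
      have h2 : x * ((a + 1) * r) < x * ((r + (a + b) : ℕ) : ℝ) := by nlinarith
      have h3 := lt_of_mul_lt_mul_left h2 hx0.le
      have h4 : (a + 1) * r < r + (a + b) := by exact_mod_cast h3
      nlinarith
    have hbpos : 0 < b := by nlinarith
    have hya := hb hbpos
    have hya0 : 0 ≤ y a := hx0.le.trans (hxy a (by omega))
    have hVa0 := hV a (by omega)
    calc W ≤ (((r + (a + b) : ℕ) : ℝ) * y a / r) ^ r * V a := hW a (by omega)
      _ ≤ (((r + (a + b) : ℕ) : ℝ) * (c ^ 2 * r) / r) ^ r * V a := by gcongr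
      _ = (1 + ((a + b : ℕ) : ℝ) / r) ^ r * ((c ^ 2 * r) ^ r * V a) := by
          rw [← mul_assoc ((1 + ((a + b : ℕ) : ℝ) / r) ^ r), ← mul_pow, Nat.cast_add r]
          congr 2
          field_simp
      _ ≤ (1 + x) ^ b * ((c ^ 2 * r) ^ r * V a) := by
          gcongr
          exact one_add_div_pow_le hr3 hx hab
      _ = (c ^ 2 * r) ^ r * ((1 + x) ^ b * V a) := by ring
      _ ≤ (c ^ 2 * r) ^ r * V (a + b) := by gcongr

/-- If the starting `r × r` submatrix `A_{S r}` has squared volume within a factor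
`c^{2r} r^r` of the maximum among `r × r` submatrices, and rows are appended greedily to
maximize volume until size `n`, then every `n × r` row submatrix has squared volume at most
`max((e·n/r)^r, (c²·r)^r)` times that of the resulting submatrix `A_{S n}`. -/
theorem statement8 (N r n : ℕ) (c : ℝ) (hc : 1 ≤ c) (hrn : r ≤ n) (hnN : n ≤ N)
    (A : Matrix (Fin N) (Fin r) ℂ)
    (S : ℕ → Finset (Fin N)) (hcard : ∀ k, r ≤ k → k ≤ n → (S k).card = k)
    (hinit : ∀ T : Finset (Fin N), T.card = r →
      sqVol A T ≤ c ^ (2 * r) * (r : ℝ) ^ r * sqVol A (S r))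
    (hstep : ∀ k, r ≤ k → k < n → ∃ i ∉ S k, S (k + 1) = insert i (S k) ∧
      ∀ j ∉ S k, sqVol A (insert j (S k)) ≤ sqVol A (insert i (S k))) :
    ∀ T : Finset (Fin N), T.card = n →
      sqVol A T ≤ max ((Real.exp 1 * (n : ℝ) / (r : ℝ)) ^ r) ((c ^ 2 * (r : ℝ)) ^ r)
        * sqVol A (S n) := by
  intro T hT
  obtain ⟨d, rfl⟩ := Nat.exists_eq_add_of_le hrn
  rcases Nat.eq_zero_or_pos r with rfl | hr
  · simp [sqVol]
  have hr' : (0 : ℝ) < r := by exact_mod_cast hr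
  have hcr : (c ^ 2 * (r : ℝ)) ^ r = c ^ (2 * r) * (r : ℝ) ^ r := by rw [mul_pow, ← pow_mul]
  set v : Fin N → Fin r → ℂ := fun i => star (A i)
  have hvol : ∀ R, sqVol A R = (gramSum v R).det.re := fun R => by
    rw [sqVol, rowsSub_conjTranspose_mul_self]
  simp only [hvol] at hinit hstep ⊢
  have hchoose := gramSum_det_le_choose_mul v hinit d T hT
  rw [← hcr] at hchoose
  by_cases h0 : (gramSum v (S r)).det.re = 0
  · rw [h0, mul_zero, mul_zero] at hchoose
    exact hchoose.trans (mul_nonneg (le_max_of_le_left (by positivity))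
      (gramSum_det_re_nonneg v _))
  have hmono : ∀ k l, k + l ≤ d → S (r + k) ⊆ S (r + (k + l)) := by
    intro k l
    induction l with
    | zero => intro _; exact subset_rfl
    | succ l ih =>
      intro hl
      obtain ⟨i, -, hi, -⟩ := hstep (r + (k + l)) (by omega) (by omega)
      rw [← add_assoc k, ← add_assoc r, hi]
      exact (ih (by omega)).trans (Finset.subset_insert _ _)
  have hpd : ∀ k ≤ d, (gramSum v (S (r + k))).PosDef := fun k hk => by
    have hsub : S r ⊆ S (r + k) := by simpa using hmono 0 k (by omega)
    have h : gramSum v (S (r + k)) = gramSum v (S (r + k) \ S r) + gramSum v (S r) :=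
      (Finset.sum_sdiff hsub).symm
    rw [h]
    exact (gramSum_posDef v h0).posSemidef_add (gramSum_posSemidef v _)
  have hTne : T.Nonempty := Finset.card_pos.mp (by omega)
  obtain ⟨j, hjT, hj⟩ := T.exists_max_image (fun j => leverage (gramSum v (S (r + d))) (v j)) hTne
  have hVd := gramSum_det_re_nonneg v (S (r + d))
  set x := leverage (gramSum v (S (r + d))) (v j)
  have hx0 : 0 ≤ x := (hpd d le_rfl).leverage_nonneg _
  have hWd := gramSum_det_le v (hpd d le_rfl) hj
  rw [hT] at hWd
  rcases le_or_gt x (Real.exp 1) with hxe | hxe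
  · refine hWd.trans (mul_le_mul_of_nonneg_right (le_max_of_le_left ?_) hVd)
    rw [mul_comm (Real.exp 1)]
    gcongr
  refine le_trans ?_ (mul_le_mul_of_nonneg_right (le_max_right _ _) hVd)
  rcases le_or_gt (((r + d : ℕ) : ℝ) * x / r) (c ^ 2 * r) with hxc | hxc
  · exact hWd.trans (by gcongr)
  have hx1 : 1 < x := lt_trans (by linarith [Real.exp_one_gt_d9]) hxe
  have hjS : j ∉ S (r + d) := fun h => (leverage_le_one v (hpd d le_rfl) h).not_gt hx1
  have hy : ∀ k < d, ∃ y, (gramSum v (S (r + (k + 1)))).det.re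
      = (gramSum v (S (r + k))).det.re * (1 + y) ∧
      ∀ l ∉ S (r + k), leverage (gramSum v (S (r + k))) (v l) ≤ y := fun k hk => by
    obtain ⟨i, hi, hSi, hmax⟩ := hstep (r + k) (by omega) (by omega)
    refine ⟨leverage (gramSum v (S (r + k))) (v i), ?_, fun l hl => ?_⟩
    · rw [← add_assoc, hSi, gramSum_insert_det v (hpd k hk.le) hi]
    · have := hmax l hl
      rw [gramSum_insert_det v (hpd k hk.le) hi, gramSum_insert_det v (hpd k hk.le) hl] at this
      linarith [le_of_mul_le_mul_left this (Complex.pos_iff.mp (hpd k hk.le).det_pos).1]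
  choose! y hyV hymax using hy
  have hxy : ∀ k < d, x ≤ y k := fun k hk => by
    have hsub : S (r + k) ⊆ S (r + d) := by
      have := hmono k (d - k) (by omega)
      rwa [Nat.add_sub_cancel' hk.le] at this
    exact (leverage_gramSum_anti v (hpd k hk.le) hsub _).trans
      (hymax k hk j fun h => hjS (hsub h))
  refine le_pow_mul_of_greedy (V := fun k => (gramSum v (S (r + k))).det.re) (x := x) hr hc
    (fun k _ => gramSum_det_re_nonneg v _) hyV hxe.le hxy hchoose (fun k hk => ?_) hxc.le
  have h := gramSum_det_le v (T := T) (x := y k) (hpd k hk.le) fun l _ => by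
    by_cases hl : l ∈ S (r + k)
    · exact (leverage_le_one v (hpd k hk.le) hl).trans (hx1.le.trans (hxy k hk))
    · exact hymax k hk l hl
  rwa [hT] at h
end

section
/- Let A be an M × N complex matrix of rank at least r (r ≥ 1). Then there exist a set I of r row indices and a set J of r column indices such that the r × r submatrix Â = A_{I,J} is invertible and the skeleton (cross) approximation C Â^{-1} R, with C = A_{:,J} (the columns of A indexed by J) and R = A_{I,:} (the rows of A indexed by I), satisfies ‖A − C Â^{-1} R‖_F ≤ (r + 1) · ‖A − B‖_F for every M × N complex matrix B of rank at most r. -/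
open Matrix BigOperators

/-- The Frobenius norm of a complex matrix. -/
noncomputable def frobNorm {M N : ℕ} (A : Matrix (Fin M) (Fin N) ℂ) : ℝ :=
  Real.sqrt (∑ i, ∑ j, ‖A i j‖ ^ 2)

namespace Matrix

variable {m n R : Type*} [Fintype m] [Fintype n] [DecidableEq n] [CommRing R]

/-- Expansion of `det (P * Q)` over all choices of inner indices. -/
theorem det_mul_eq_sum_det_submatrix (P : Matrix n m R) (Q : Matrix m n R) :
    (P * Q).det = ∑ κ : n → m, (P.submatrix id κ).det * ∏ i, Q (κ i) i := by
  classical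
  simp only [det_apply', mul_apply, Finset.prod_univ_sum, Finset.mul_sum, Fintype.piFinset_univ,
    Finset.sum_mul]
  rw [Finset.sum_comm]
  simp [Finset.prod_mul_distrib, mul_assoc]

/-- The Cauchy–Binet formula, summed over all functions instead of all subsets. -/
theorem sum_det_submatrix_mul_det_submatrix (P : Matrix n m R) (Q : Matrix m n R) :
    ∑ κ : n → m, (P.submatrix id κ).det * (Q.submatrix κ id).det =
      (Fintype.card n).factorial * (P * Q).det := by
  classical
  have key (τ : Equiv.Perm n) :
      ∑ κ : n → m, (P.submatrix id κ).det * (((τ.sign : ℤ) : R) * ∏ i, Q (κ (τ i)) i) =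
        (P * Q).det := by
    rw [det_mul_eq_sum_det_submatrix]
    refine Fintype.sum_equiv (Equiv.arrowCongr τ.symm (Equiv.refl m)) _ _ fun κ ↦ ?_
    have h : P.submatrix id (κ ∘ τ) = (P.submatrix id κ).submatrix id τ := rfl
    have hκ : Equiv.arrowCongr τ.symm (Equiv.refl m) κ = κ ∘ τ := by ext; simp
    rw [hκ, h, det_permute']
    simp only [Function.comp_apply]
    ring
  calc _ = ∑ τ : Equiv.Perm n,
        ∑ κ : n → m, (P.submatrix id κ).det * (((τ.sign : ℤ) : R) * ∏ i, Q (κ (τ i)) i) := by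
        rw [Finset.sum_comm]
        refine Finset.sum_congr rfl fun κ _ ↦ ?_
        rw [← Finset.mul_sum, det_apply' (Q.submatrix κ id)]
        rfl
    _ = _ := by simp [key, Fintype.card_perm]

end Matrix

/-- `Fin (r + 1)` as the disjoint union of the complement of `s` and `{s}`. -/
def finSumUnitEquiv {r : ℕ} (s : Fin (r + 1)) : Fin r ⊕ Unit ≃ Fin (r + 1) :=
  ((finSuccEquiv' s).trans (Equiv.optionEquivSumPUnit _)).symm

theorem insertNth_comp_finSumUnitEquiv {r : ℕ} {α : Type*} (s : Fin (r + 1)) (a : α)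
    (f : Fin r → α) :
    (s.insertNth a f : Fin (r + 1) → α) ∘ finSumUnitEquiv s = Sum.elim f fun _ ↦ a := by
  funext x
  rcases x with x | x <;> simp [finSumUnitEquiv]

theorem det_submatrix_insertNth {r : ℕ} {m n R : Type*} [CommRing R] (X : Matrix m n R)
    (s : Fin (r + 1)) (i : m) (j : n) (ι : Fin r → m) (κ : Fin r → n) :
    (X.submatrix (s.insertNth i ι : Fin (r + 1) → m) (s.insertNth j κ : Fin (r + 1) → n)).det =
      (fromBlocks (X.submatrix ι κ) (X.submatrix ι fun _ : Unit ↦ j)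
        (X.submatrix (fun _ : Unit ↦ i) κ) (X.submatrix (fun _ : Unit ↦ i) fun _ ↦ j)).det := by
  rw [← det_submatrix_equiv_self (finSumUnitEquiv s), submatrix_submatrix,
    insertNth_comp_finSumUnitEquiv, insertNth_comp_finSumUnitEquiv]
  congr 1
  ext (x | x) (y | y) <;> rfl

theorem det_submatrix_insertNth_eq_mul {r : ℕ} {m n R : Type*} [CommRing R] (X : Matrix m n R)
    (s : Fin (r + 1)) (i : m) (j : n) (ι : Fin r → m) (κ : Fin r → n)
    (h : IsUnit (X.submatrix ι κ).det) :
    (X.submatrix (s.insertNth i ι : Fin (r + 1) → m) (s.insertNth j κ : Fin (r + 1) → n)).det =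
      (X.submatrix ι κ).det *
        (X - X.submatrix id κ * (X.submatrix ι κ)⁻¹ * X.submatrix ι id) i j := by
  have := invertibleOfIsUnitDet _ h
  rw [det_submatrix_insertNth, det_fromBlocks₁₁, invOf_eq_nonsing_inv]
  congr 1
  exact det_unique _

section MinorSums

open scoped ComplexOrder

/-- Fischer's inequality for bordering a principal minor by one row and column. -/
theorem Matrix.PosSemidef.det_submatrix_insertNth_le {r : ℕ} {m : Type*} [Finite m]
    {H : Matrix m m ℂ} (hH : H.PosSemidef) (s : Fin (r + 1)) (i : m) (ι : Fin r → m) :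
    (H.submatrix (s.insertNth i ι : Fin (r + 1) → m)
      (s.insertNth i ι : Fin (r + 1) → m)).det ≤ H i i * (H.submatrix ι ι).det := by
  by_cases h0 : (H.submatrix (s.insertNth i ι : Fin (r + 1) → m)
      (s.insertNth i ι : Fin (r + 1) → m)).det = 0
  · rw [h0]
    exact mul_nonneg hH.diag_nonneg (hH.submatrix ι).det_nonneg
  have hpd : (H.submatrix (s.insertNth i ι : Fin (r + 1) → m)
      (s.insertNth i ι : Fin (r + 1) → m)).PosDef :=
    (hH.submatrix _).posDef_iff_det_ne_zero.2 h0
  have hι : (H.submatrix ι ι).PosDef := by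
    have := hpd.submatrix (e := s.succAbove) Fin.succAbove_right_injective
    have he : (s.insertNth i ι : Fin (r + 1) → m) ∘ s.succAbove = ι := by ext; simp
    rwa [submatrix_submatrix, he] at this
  rw [det_submatrix_insertNth_eq_mul _ _ _ _ _ _ hι.det_pos.ne'.isUnit, mul_comm]
  refine mul_le_mul_of_nonneg_right ?_ hι.det_pos.le
  rw [sub_apply, sub_le_self_iff]
  have := Fintype.ofFinite m
  have h := hι.posSemidef.inv.conjTranspose_mul_mul_same (H.submatrix ι id)
  rw [conjTranspose_submatrix, hH.isHermitian.eq] at h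
  exact h.diag_nonneg

variable {m n : Type*} [Fintype n]

/-- The sum of the squared absolute values of all `k × k` minors of `A` with rows `ι`. -/
noncomputable def rowMinorSum {k : ℕ} (A : Matrix m n ℂ) (ι : Fin k → m) : ℝ :=
  ∑ κ : Fin k → n, ‖(A.submatrix ι κ).det‖ ^ 2

theorem rowMinorSum_nonneg {k : ℕ} (A : Matrix m n ℂ) (ι : Fin k → m) : 0 ≤ rowMinorSum A ι :=
  Finset.sum_nonneg fun _ _ ↦ sq_nonneg _

theorem ofReal_rowMinorSum {k : ℕ} (A : Matrix m n ℂ) (ι : Fin k → m) :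
    (rowMinorSum A ι : ℂ) = k.factorial * ((A * Aᴴ).submatrix ι ι).det := by
  have h := sum_det_submatrix_mul_det_submatrix (A.submatrix ι id) (A.submatrix ι id)ᴴ
  rw [Fintype.card_fin] at h
  have h' : A.submatrix ι id * (A.submatrix ι id)ᴴ = (A * Aᴴ).submatrix ι ι := rfl
  rw [← h', ← h, rowMinorSum]
  push_cast
  refine Finset.sum_congr rfl fun κ _ ↦ ?_
  have h2 : (A.submatrix ι id)ᴴ.submatrix κ id = (A.submatrix ι κ)ᴴ := rfl
  rw [h2, det_conjTranspose, ← Complex.mul_conj']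
  rfl

theorem mul_conjTranspose_self_apply_self (A : Matrix m n ℂ) (i : m) :
    (A * Aᴴ) i i = ((∑ j, ‖A i j‖ ^ 2 : ℝ) : ℂ) := by
  push_cast
  simp [mul_apply, Complex.mul_conj']

theorem rowMinorSum_insertNth_le [Finite m] {r : ℕ} (A : Matrix m n ℂ) (s : Fin (r + 1)) (i : m)
    (ι : Fin r → m) :
    rowMinorSum A (s.insertNth i ι : Fin (r + 1) → m) ≤
      (r + 1) * ((∑ j, ‖A i j‖ ^ 2) * rowMinorSum A ι) := by
  rw [← Complex.real_le_real]
  push_cast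
  have h := (posSemidef_self_mul_conjTranspose A).det_submatrix_insertNth_le s i ι
  rw [mul_conjTranspose_self_apply_self] at h
  push_cast at h
  rw [ofReal_rowMinorSum, ofReal_rowMinorSum, Nat.factorial_succ]
  push_cast
  calc _ ≤ ((r : ℂ) + 1) * r.factorial * _ := mul_le_mul_of_nonneg_left h (by positivity)
    _ = _ := by ring

theorem rowMinorSum_eq_zero_of_not_injective {k : ℕ} (A : Matrix m n ℂ) {ι : Fin k → m}
    (h : ¬ Function.Injective ι) : rowMinorSum A ι = 0 := by
  simp only [Function.Injective, not_forall] at h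
  obtain ⟨a, b, hab, hne⟩ := h
  refine Finset.sum_eq_zero fun κ _ ↦ ?_
  rw [det_zero_of_row_eq hne (by ext; simp [hab])]
  simp

variable [Fintype m]

/-- The sum of the squared absolute values of all `k × k` minors of `A`, over all ordered choices
of rows and columns. -/
noncomputable def minorSum (k : ℕ) (A : Matrix m n ℂ) : ℝ :=
  ∑ ι : Fin k → m, rowMinorSum A ι

theorem minorSum_conjTranspose (k : ℕ) (A : Matrix m n ℂ) : minorSum k Aᴴ = minorSum k A := by
  simp only [minorSum, rowMinorSum]
  rw [Finset.sum_comm]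
  refine Finset.sum_congr rfl fun ι _ ↦ Finset.sum_congr rfl fun κ _ ↦ ?_
  rw [← conjTranspose_submatrix, det_conjTranspose, norm_star]

theorem minorSum_mul_left_of_conjTranspose_mul_self_eq_one [DecidableEq m] (k : ℕ)
    {U : Matrix m m ℂ} (hU : Uᴴ * U = 1) (A : Matrix m n ℂ) :
    minorSum k (U * A) = minorSum k A := by
  rw [← minorSum_conjTranspose, ← minorSum_conjTranspose k A]
  refine Finset.sum_congr rfl fun κ _ ↦ ?_
  have h : (U * A)ᴴ * (U * A)ᴴᴴ = Aᴴ * Aᴴᴴ := by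
    simp only [conjTranspose_conjTranspose, conjTranspose_mul]
    rw [Matrix.mul_assoc, ← Matrix.mul_assoc Uᴴ, hU, Matrix.one_mul]
  apply Complex.ofReal_injective
  rw [ofReal_rowMinorSum, ofReal_rowMinorSum, h]

theorem minorSum_succ_le [DecidableEq m] {r : ℕ} (A : Matrix m n ℂ) (S : Finset m)
    (hS : S.card ≤ r) :
    minorSum (r + 1) A ≤ (r + 1) ^ 2 * ((∑ i ∈ Sᶜ, ∑ j, ‖A i j‖ ^ 2) * minorSum r A) := by
  have h1 (ι : Fin (r + 1) → m) :
      rowMinorSum A ι ≤ ∑ s, if ι s ∈ Sᶜ then rowMinorSum A ι else 0 := by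
    have hnn (s : Fin (r + 1)) : 0 ≤ if ι s ∈ Sᶜ then rowMinorSum A ι else 0 := by
      split_ifs
      exacts [rowMinorSum_nonneg A ι, le_rfl]
    by_cases hι : Function.Injective ι
    · obtain ⟨s, hs⟩ : ∃ s, ι s ∉ S := by
        by_contra! h
        have := Finset.card_le_card_of_injOn (s := Finset.univ) ι (fun s _ ↦ h s) hι.injOn
        simp at this
        omega
      have := Finset.single_le_sum (fun s _ ↦ hnn s) (Finset.mem_univ s)
      rwa [if_pos (by simpa using hs)] at this
    · rw [rowMinorSum_eq_zero_of_not_injective A hι]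
      simp
  have h2 (s : Fin (r + 1)) :
      ∑ ι : Fin (r + 1) → m, (if ι s ∈ Sᶜ then rowMinorSum A ι else 0) ≤
        (r + 1) * ((∑ i ∈ Sᶜ, ∑ j, ‖A i j‖ ^ 2) * minorSum r A) := by
    rw [← (Fin.insertNthEquiv (fun _ ↦ m) s).sum_comp, Fintype.sum_prod_type, Finset.sum_mul,
      Finset.mul_sum, ← Finset.sum_subset (Finset.subset_univ Sᶜ)]
    · refine Finset.sum_le_sum fun i hi ↦ ?_
      rw [minorSum, Finset.mul_sum, Finset.mul_sum]
      refine Finset.sum_le_sum fun ι _ ↦ ?_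
      simpa [Finset.mem_compl.1 hi, Fin.insertNthEquiv] using rowMinorSum_insertNth_le A s i ι
    · intro i _ hi
      exact Finset.sum_eq_zero fun ι _ ↦ by simpa using fun h ↦ absurd h (by simpa using hi)
  calc minorSum (r + 1) A
      ≤ ∑ ι : Fin (r + 1) → m, ∑ s, if ι s ∈ Sᶜ then rowMinorSum A ι else 0 :=
        Finset.sum_le_sum fun ι _ ↦ h1 ι
    _ = ∑ s, ∑ ι : Fin (r + 1) → m, if ι s ∈ Sᶜ then rowMinorSum A ι else 0 := Finset.sum_comm
    _ ≤ ∑ _s : Fin (r + 1), (r + 1) * ((∑ i ∈ Sᶜ, ∑ j, ‖A i j‖ ^ 2) * minorSum r A) :=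
        Finset.sum_le_sum fun s _ ↦ h2 s
    _ = _ := by
        rw [Finset.sum_const, Finset.card_univ, Fintype.card_fin, nsmul_eq_mul]
        push_cast
        ring

theorem sum_norm_sq_mul_left_of_conjTranspose_mul_self_eq_one [DecidableEq m] {U : Matrix m m ℂ}
    (hU : Uᴴ * U = 1) (A : Matrix m n ℂ) :
    ∑ i, ∑ j, ‖(U * A) i j‖ ^ 2 = ∑ i, ∑ j, ‖A i j‖ ^ 2 := by
  have h (X : Matrix m n ℂ) :
      ((∑ i, ∑ j, ‖X i j‖ ^ 2 : ℝ) : ℂ) = (Xᴴ * X).trace := by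
    rw [trace_mul_comm, trace, Complex.ofReal_sum]
    exact Finset.sum_congr rfl fun i _ ↦ (mul_conjTranspose_self_apply_self X i).symm
  apply Complex.ofReal_injective
  rw [h, h, conjTranspose_mul, Matrix.mul_assoc, ← Matrix.mul_assoc Uᴴ, hU, Matrix.one_mul]

/-- Some unitary matrix compresses `B` to at most `B.rank` nonzero rows. -/
theorem exists_unitary_mul_row_eq_zero [DecidableEq m] (B : Matrix m n ℂ) :
    ∃ (U : Matrix m m ℂ) (S : Finset m), Uᴴ * U = 1 ∧ S.card = B.rank ∧
      ∀ i ∉ S, ∀ j, (U * B) i j = 0 := by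
  have hH := isHermitian_mul_conjTranspose_self B
  set Q : Matrix m m ℂ := ↑hH.eigenvectorUnitary with hQ
  refine ⟨Qᴴ, Finset.univ.filter (hH.eigenvalues · ≠ 0), ?_, ?_, fun i hi ↦ ?_⟩
  · rw [conjTranspose_conjTranspose]
    exact Unitary.coe_mul_star_self hH.eigenvectorUnitary
  · rw [← rank_self_mul_conjTranspose, hH.rank_eq_card_non_zero_eigs, Fintype.card_subtype]
  · have hd : (Qᴴ * B) * (Qᴴ * B)ᴴ = diagonal (RCLike.ofReal ∘ hH.eigenvalues) := by
      rw [← hH.conjStarAlgAut_star_eigenvectorUnitary, Unitary.conjStarAlgAut_star_apply,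
        conjTranspose_mul, conjTranspose_conjTranspose, star_eq_conjTranspose]
      simp only [Matrix.mul_assoc, hQ]
    have h := congr_fun (congr_fun hd i) i
    have hi' : hH.eigenvalues i = 0 := by simpa using hi
    rw [mul_conjTranspose_self_apply_self, diagonal_apply_eq, Function.comp_apply, hi',
      RCLike.ofReal_zero, Complex.ofReal_eq_zero,
      Finset.sum_eq_zero_iff_of_nonneg fun _ _ ↦ sq_nonneg _] at h
    intro j
    simpa using h j (Finset.mem_univ j)

theorem minorSum_succ_le_of_rank_le [DecidableEq m] {r : ℕ} (A B : Matrix m n ℂ)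
    (hB : B.rank ≤ r) :
    minorSum (r + 1) A ≤ (r + 1) ^ 2 * ((∑ i, ∑ j, ‖(A - B) i j‖ ^ 2) * minorSum r A) := by
  obtain ⟨U, S, hU, hS, h0⟩ := exists_unitary_mul_row_eq_zero B
  have hT : ∑ i ∈ Sᶜ, ∑ j, ‖(U * A) i j‖ ^ 2 ≤ ∑ i, ∑ j, ‖(A - B) i j‖ ^ 2 := by
    rw [← sum_norm_sq_mul_left_of_conjTranspose_mul_self_eq_one hU (A - B)]
    calc _ = ∑ i ∈ Sᶜ, ∑ j, ‖(U * (A - B)) i j‖ ^ 2 := by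
          refine Finset.sum_congr rfl fun i hi ↦ Finset.sum_congr rfl fun j _ ↦ ?_
          rw [Matrix.mul_sub, Matrix.sub_apply, h0 i (Finset.mem_compl.1 hi) j, sub_zero]
      _ ≤ _ := Finset.sum_le_sum_of_subset_of_nonneg (Finset.subset_univ _) fun _ _ _ ↦
          Finset.sum_nonneg fun _ _ ↦ sq_nonneg _
  have h := minorSum_succ_le (U * A) S (hS.trans_le hB)
  simp only [minorSum_mul_left_of_conjTranspose_mul_self_eq_one _ hU] at h
  have h0 : 0 ≤ minorSum r A := Finset.sum_nonneg fun ι _ ↦ rowMinorSum_nonneg A ι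
  exact h.trans (by gcongr)

theorem exists_det_submatrix_ne_zero {r : ℕ} (A : Matrix m n ℂ) (h : r ≤ A.rank) :
    ∃ (ι : Fin r → m) (κ : Fin r → n), (A.submatrix ι κ).det ≠ 0 := by
  obtain ⟨k, a, ha, hsp, hli⟩ := exists_linearIndependent' ℂ A.row
  have := Finite.of_injective a ha
  have := Fintype.ofFinite k
  have hk : Fintype.card k = A.rank := by
    rw [rank_eq_finrank_span_row, ← hsp]
    exact linearIndependent_iff_card_eq_finrank_span.1 hli
  obtain ⟨e⟩ : Nonempty (Fin r ↪ k) :=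
    Function.Embedding.nonempty_of_card_le (by rwa [Fintype.card_fin, hk])
  have hpd : (A.submatrix (a ∘ e) id * (A.submatrix (a ∘ e) id)ᴴ).PosDef :=
    PosDef.mul_conjTranspose_self _ (vecMul_injective_iff.2 (hli.comp e e.injective))
  by_contra! h0
  have h1 := ofReal_rowMinorSum A (a ∘ e)
  have h2 : rowMinorSum A (a ∘ e) = 0 := Finset.sum_eq_zero fun κ _ ↦ by simp [h0]
  rw [h2, Complex.ofReal_zero, zero_eq_mul] at h1
  exact h1.elim (by simp [Nat.factorial_ne_zero]) hpd.det_pos.ne'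

theorem sum_norm_sq_det_mul_le_minorSum_succ (r : ℕ) (A : Matrix m n ℂ) :
    ∑ ι : Fin r → m, ∑ κ : Fin r → n,
      (if (A.submatrix ι κ).det = 0 then 0 else ‖(A.submatrix ι κ).det‖ ^ 2 * ∑ i, ∑ j,
        ‖(A - A.submatrix id κ * (A.submatrix ι κ)⁻¹ * A.submatrix ι id) i j‖ ^ 2) ≤
      minorSum (r + 1) A := by
  have h : minorSum (r + 1) A = ∑ ι : Fin r → m, ∑ κ : Fin r → n, ∑ i, ∑ j,
      ‖(A.submatrix ((0 : Fin (r + 1)).insertNth i ι : Fin (r + 1) → m)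
        ((0 : Fin (r + 1)).insertNth j κ : Fin (r + 1) → n)).det‖ ^ 2 := by
    simp only [minorSum, rowMinorSum]
    rw [← (Fin.insertNthEquiv (fun _ ↦ m) 0).sum_comp, Fintype.sum_prod_type_right]
    refine Finset.sum_congr rfl fun ι _ ↦ ?_
    conv_rhs => rw [Finset.sum_comm]
    refine Finset.sum_congr rfl fun i _ ↦ ?_
    rw [← (Fin.insertNthEquiv (fun _ ↦ n) 0).sum_comp, Fintype.sum_prod_type_right]
    rfl
  rw [h]
  refine Finset.sum_le_sum fun ι _ ↦ Finset.sum_le_sum fun κ _ ↦ ?_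
  split_ifs with h0
  · positivity
  · rw [Finset.mul_sum]
    refine Finset.sum_le_sum fun i _ ↦ ?_
    rw [Finset.mul_sum]
    refine Finset.sum_le_sum fun j _ ↦ ?_
    rw [det_submatrix_insertNth_eq_mul A 0 i j ι κ (Ne.isUnit h0), norm_mul, mul_pow]

end MinorSums

/-- For every `M × N` complex matrix `A` of rank at least `r ≥ 1` there exist `r` rows and
`r` columns such that the `r × r` submatrix `Â` at their intersection is invertible and the
skeleton approximation `C Â⁻¹ R` (with `C` the chosen columns and `R` the chosen rows)
satisfies `‖A − C Â⁻¹ R‖_F ≤ (r+1)·‖A − B‖_F` for every matrix `B` of rank at most `r`. -/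
theorem statement9 (M N r : ℕ) (hr : 1 ≤ r)
    (A : Matrix (Fin M) (Fin N) ℂ) (hrank : r ≤ A.rank) :
    ∃ (ι : Fin r → Fin M) (κ : Fin r → Fin N),
      Function.Injective ι ∧ Function.Injective κ ∧
      IsUnit (A.submatrix ι κ).det ∧
      ∀ B : Matrix (Fin M) (Fin N) ℂ, B.rank ≤ r →
        frobNorm (A - A.submatrix id κ * (A.submatrix ι κ)⁻¹ * A.submatrix ι id)
          ≤ ((r : ℝ) + 1) * frobNorm (A - B) := by
  let E (p : (Fin r → Fin M) × (Fin r → Fin N)) : ℝ := ∑ i, ∑ j,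
    ‖(A - A.submatrix id p.2 * (A.submatrix p.1 p.2)⁻¹ * A.submatrix p.1 id) i j‖ ^ 2
  obtain ⟨ι₀, κ₀, h₀⟩ := exists_det_submatrix_ne_zero A hrank
  obtain ⟨⟨ι, κ⟩, hp, hmin⟩ := Finset.exists_min_image
    (Finset.univ.filter fun p : (Fin r → Fin M) × (Fin r → Fin N) ↦
      (A.submatrix p.1 p.2).det ≠ 0) E ⟨(ι₀, κ₀), by simpa using h₀⟩
  have hdet : (A.submatrix ι κ).det ≠ 0 := by simpa using hp
  refine ⟨ι, κ, fun a b hab ↦ ?_, fun a b hab ↦ ?_, hdet.isUnit, fun B hB ↦ ?_⟩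
  · by_contra hne
    exact hdet (det_zero_of_row_eq hne (by ext; simp [hab]))
  · by_contra hne
    exact hdet (det_zero_of_column_eq hne (by simp [hab]))
  have hpos : 0 < minorSum r A := by
    refine (by positivity : 0 < ‖(A.submatrix ι κ).det‖ ^ 2).trans_le ?_
    refine le_trans ?_ (Finset.single_le_sum (f := rowMinorSum A)
      (fun ι _ ↦ rowMinorSum_nonneg A ι) (Finset.mem_univ ι))
    exact Finset.single_le_sum (f := fun κ ↦ ‖(A.submatrix ι κ).det‖ ^ 2)
      (fun _ _ ↦ sq_nonneg _) (Finset.mem_univ κ)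
  have hE : minorSum r A * E (ι, κ) ≤ minorSum (r + 1) A := by
    refine le_trans ?_ (sum_norm_sq_det_mul_le_minorSum_succ r A)
    simp only [minorSum, rowMinorSum, Finset.sum_mul]
    refine Finset.sum_le_sum fun ι' _ ↦ Finset.sum_le_sum fun κ' _ ↦ ?_
    split_ifs with h
    · simp [h]
    · exact mul_le_mul_of_nonneg_left (hmin (ι', κ') (by simpa using h)) (sq_nonneg _)
  have hle : E (ι, κ) ≤ (r + 1) ^ 2 * ∑ i, ∑ j, ‖(A - B) i j‖ ^ 2 := by
    refine le_of_mul_le_mul_left (hE.trans ((minorSum_succ_le_of_rank_le A B hB).trans_eq ?_)) hpos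
    ring
  rw [frobNorm, frobNorm, ← Real.sqrt_sq (by positivity : (0 : ℝ) ≤ r + 1),
    ← Real.sqrt_mul (sq_nonneg _)]
  exact Real.sqrt_le_sqrt hle
end
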